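/- (Classification of fourfolds with trivial canonical bundle in Gr(k,n), k, n−k ≥ 4, bundles with |β|₂ = 0; here 0^j denotes j consecutive zeros.) Let k ≥ 4 and n − k ≥ 4, and let β¹, …, β^m be nonzero weights for Gr(k,n) such that: every β^i satisfies β^i_{k+1} = … = β^i_n = 0; no β^i equals (1, 0^{n−1}); if 2k > n then no β^i equals (1,1,0^{n−2}) or (2,0^{n−1}); ∑_i rank(β^i) = k(n−k) − 4; and ∑_i dex(β^i) = n. Then, up to reordering, (k, n, (β¹,…,β^m)) is one of the following eight: (1) k=4, n=9, weights (1,1,1,0^6), (1,1,0^7), (1,1,0^7); (2) k=5, n=10, weights (1,1,0^8), (1,1,0^8), (2,2,2,2,2,0^5); (3) k=6, n=12, weights (1,1,0^{10}), (1,1,0^{10}), (1,1,1,1,1,1,0^6), (1,1,1,1,1,1,0^6); (4) k=5, n=11, weights (1,1,0^9), (2,0^{10}), (1,1,1,1,1,0^6); (5) k=4, n=10, weights (2,0^9), (2,0^9); (6) k=4, n=8, weights (2,0^7), (1,1,1,1,0^4), (2,2,2,2,0^4); (7) k=4, n=8, weights (1,1,0^6), (1,1,1,0^5), (1,1,1,1,0^4),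 (1,1,1,1,0^4); (8) k=6, n=10, the single weight (1,1,1,0^7). -/

import Mathlib

open Finset

/-- Weyl dimension formula `D_r` for `sl(r)`, applied to the entries
`β 0, …, β (r-1)` (0-indexed versions of `β₁, …, β_r`). -/
def slDim (r : ℕ) (β : ℕ → ℚ) : ℚ :=
  ∏ i ∈ Finset.range r, ∏ j ∈ Finset.range r,
    if i < j then ((j : ℚ) - (i : ℚ) + β i - β j) / ((j : ℚ) - (i : ℚ)) else 1

/-- Weyl dimension formula `C_m` for `sp(2m)`. -/
def spDim (m : ℕ) (β : ℕ → ℚ) : ℚ :=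
  slDim m β *
    ∏ i ∈ Finset.range m, ∏ j ∈ Finset.range m,
      if i ≤ j then
        ((2 * m : ℚ) - (i : ℚ) - (j : ℚ) + β i + β j) /
          ((2 * m : ℚ) - (i : ℚ) - (j : ℚ))
      else 1

/-- Weyl dimension formula `B_m` for `so(2m+1)`. -/
def soOddDim (m : ℕ) (β : ℕ → ℚ) : ℚ :=
  slDim m β *
    ∏ i ∈ Finset.range m, ∏ j ∈ Finset.range m,
      if i ≤ j then
        ((2 * m : ℚ) - 1 - (i : ℚ) - (j : ℚ) + β i + β j) /
          ((2 * m : ℚ) - 1 - (i : ℚ) - (j : ℚ))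
      else 1

/-- Weyl dimension formula `E_m` for `so(2m)`. -/
def soEvenDim (m : ℕ) (β : ℕ → ℚ) : ℚ :=
  slDim m β *
    ∏ i ∈ Finset.range m, ∏ j ∈ Finset.range m,
      if i < j then
        ((2 * m : ℚ) - 2 - (i : ℚ) - (j : ℚ) + β i + β j) /
          ((2 * m : ℚ) - 2 - (i : ℚ) - (j : ℚ))
      else 1

/-- The tuple determined by a list, extended by zeros. -/
def lw (l : List ℚ) : ℕ → ℚ := fun i => l.getD i 0

/-- `β₁ + ⋯ + β_k` (the sum of the first `k` entries). -/
def headSum (k : ℕ) (β : ℕ → ℚ) : ℚ := ∑ i ∈ Finset.range k, β i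

/-- A weight for the ordinary Grassmannian `Gr(k,n)`: integers
`β₁ ≥ β₂ ≥ ⋯ ≥ β_n = 0`, extended by zeros beyond position `n`. -/
def IsGrWeight (n : ℕ) (β : ℕ → ℚ) : Prop :=
  (∀ i, ∃ z : ℤ, β i = (z : ℚ)) ∧ (∀ i j, i ≤ j → β j ≤ β i) ∧ ∀ i, n - 1 ≤ i → β i = 0

/-- `rank(β) = D_k(β₁,…,β_k) ⬝ D_{n-k}(β_{k+1},…,β_n)` on `Gr(k,n)`. -/
def grRank (k n : ℕ) (β : ℕ → ℚ) : ℚ := slDim k β * slDim (n - k) (fun i => β (k + i))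

/-- `dex(β) = (|β|₁/k − |β|₂/(n−k)) ⬝ rank(β)` on `Gr(k,n)`. -/
def grDex (k n : ℕ) (β : ℕ → ℚ) : ℚ :=
  (headSum k β / (k : ℚ) -
      (∑ i ∈ Finset.range (n - k), β (k + i)) / ((n : ℚ) - (k : ℚ))) * grRank k n β

/-- A weight for the symplectic Grassmannian `IGr(k,2n)`: integers
`β₁ ≥ ⋯ ≥ β_n ≥ 0`, extended by zeros beyond position `n`. -/
def IsIGrWeight (n : ℕ) (β : ℕ → ℚ) : Prop :=
  (∀ i, ∃ z : ℤ, β i = (z : ℚ)) ∧ (∀ i j, i ≤ j → β j ≤ β i) ∧ ∀ i, n ≤ i → β i = 0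

/-- `rank(β) = D_k(β₁,…,β_k) ⬝ C_{n-k}(β_{k+1},…,β_n)` on `IGr(k,2n)`. -/
def igrRank (k n : ℕ) (β : ℕ → ℚ) : ℚ := slDim k β * spDim (n - k) (fun i => β (k + i))

/-- `dex(β) = ((β₁+⋯+β_k)/k) ⬝ rank(β)` on `IGr(k,2n)`. -/
def igrDex (k n : ℕ) (β : ℕ → ℚ) : ℚ := headSum k β / (k : ℚ) * igrRank k n β

/-- A weight for the odd orthogonal Grassmannian `OGr(k,2n+1)`:
`β₁ ≥ ⋯ ≥ β_n ≥ 0`, all entries integers or all half-odd-integers,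
extended by zeros beyond position `n`. -/
def IsOGrOddWeight (n : ℕ) (β : ℕ → ℚ) : Prop :=
  ((∀ i, i < n → ∃ z : ℤ, β i = (z : ℚ)) ∨
    (∀ i, i < n → ∃ z : ℤ, β i = (z : ℚ) + 1/2)) ∧
  (∀ i j, i ≤ j → j < n → β j ≤ β i) ∧ (∀ i, i < n → 0 ≤ β i) ∧ ∀ i, n ≤ i → β i = 0

/-- `rank(β) = D_k(β₁,…,β_k) ⬝ B_{n-k}(β_{k+1},…,β_n)` on `OGr(k,2n+1)`. -/
def ogrOddRank (k n : ℕ) (β : ℕ → ℚ) : ℚ :=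
  slDim k β * soOddDim (n - k) (fun i => β (k + i))

/-- `dex(β) = ((β₁+⋯+β_k)/k) ⬝ rank(β)` on `OGr(k,2n+1)`. -/
def ogrOddDex (k n : ℕ) (β : ℕ → ℚ) : ℚ := headSum k β / (k : ℚ) * ogrOddRank k n β

/-- A weight for the even orthogonal Grassmannian `OGr(k,2n)`:
`β₁ ≥ ⋯ ≥ β_{n-1} ≥ |β_n|`, all entries integers or all half-odd-integers,
extended by zeros beyond position `n`. -/
def IsOGrEvenWeight (n : ℕ) (β : ℕ → ℚ) : Prop :=
  ((∀ i, i < n → ∃ z : ℤ, β i = (z : ℚ)) ∨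
    (∀ i, i < n → ∃ z : ℤ, β i = (z : ℚ) + 1/2)) ∧
  (∀ i j, i ≤ j → j + 1 < n → β j ≤ β i) ∧
  (∀ i, i + 1 < n → |β (n - 1)| ≤ β i) ∧ ∀ i, n ≤ i → β i = 0

/-- `rank(β) = D_k(β₁,…,β_k) ⬝ E_{n-k}(β_{k+1},…,β_n)` on `OGr(k,2n)`. -/
def ogrEvenRank (k n : ℕ) (β : ℕ → ℚ) : ℚ :=
  slDim k β * soEvenDim (n - k) (fun i => β (k + i))

/-- `dex(β) = ((β₁+⋯+β_k)/k) ⬝ rank(β)` on `OGr(k,2n)`. -/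
def ogrEvenDex (k n : ℕ) (β : ℕ → ℚ) : ℚ := headSum k β / (k : ℚ) * ogrEvenRank k n β

/-- Replace the last entry `β_n` by its negative. -/
def negLast (n : ℕ) (β : ℕ → ℚ) : ℕ → ℚ := fun i => if i = n - 1 then -β i else β i

theorem slDim_const (r : ℕ) (c : ℚ) {β : ℕ → ℚ} (h : ∀ i < r, β i = c) : slDim r β = 1 := by
  unfold slDim
  refine prod_eq_one fun i hi => prod_eq_one fun j hj => ?_
  split_ifs with hij
  · rw [h i (mem_range.1 hi), h j (mem_range.1 hj), add_sub_cancel_right, div_self]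
    exact sub_ne_zero.2 (by exact_mod_cast hij.ne')
  · rfl

/-- A product of lower bounds for the rows bounds the Weyl dimension from below. -/
theorem prod_le_slDim {k : ℕ} {β g : ℕ → ℚ} (h0 : ∀ i < k, 0 ≤ g i)
    (h : ∀ i < k, g i ≤ ∏ j ∈ range k,
      if i < j then ((j : ℚ) - (i : ℚ) + β i - β j) / ((j : ℚ) - (i : ℚ)) else 1) :
    ∏ i ∈ range k, g i ≤ slDim k β :=
  prod_le_prod (fun i hi => h0 i (mem_range.1 hi)) fun i hi => h i (mem_range.1 hi)

theorem add_div_le_factor {β : ℕ → ℚ} {i j : ℕ} {c : ℚ} (hij : i < j) (hc : c ≤ β i - β j) :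
    ((j : ℚ) - i + c) / ((j : ℚ) - i) ≤ ((j : ℚ) - (i : ℚ) + β i - β j) / ((j : ℚ) - (i : ℚ)) := by
  have : (i : ℚ) < j := by exact_mod_cast hij
  exact div_le_div_of_nonneg_right (by linarith) (by linarith)

theorem one_le_row {β : ℕ → ℚ} (hβ : Antitone β) (k i : ℕ) :
    1 ≤ ∏ j ∈ range k,
      if i < j then ((j : ℚ) - (i : ℚ) + β i - β j) / ((j : ℚ) - (i : ℚ)) else 1 := by
  refine prod_induction _ (fun x : ℚ => 1 ≤ x) (fun a b => one_le_mul_of_one_le_of_one_le)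
    le_rfl fun j _ => ?_
  split_ifs with hij
  · have : (i : ℚ) < j := by exact_mod_cast hij
    rw [one_le_div (by linarith)]
    linarith [hβ hij.le]
  · rfl

theorem one_le_slDim {β : ℕ → ℚ} (hβ : Antitone β) (k : ℕ) : 1 ≤ slDim k β := by
  simpa using prod_le_slDim (k := k) (g := fun _ => 1) (fun _ _ => zero_le_one)
    fun i _ => one_le_row hβ k i

/-- A jump of `β` just before position `p` bounds the row of any `i < p` from below. -/
theorem div_le_row {β : ℕ → ℚ} (hβ : Antitone β) {k i p : ℕ} (hip : i < p) (hpk : p ≤ k)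
    (hp : β p + 1 ≤ β (p - 1)) :
    ((k : ℚ) - i) / ((p : ℚ) - i) ≤ ∏ j ∈ range k,
      if i < j then ((j : ℚ) - (i : ℚ) + β i - β j) / ((j : ℚ) - (i : ℚ)) else 1 := by
  induction k, hpk using Nat.le_induction with
  | base =>
    have : (i : ℚ) < p := by exact_mod_cast hip
    rw [div_self (by linarith)]
    exact one_le_row hβ p i
  | succ k hk ih =>
    rw [prod_range_succ, if_pos (hip.trans_le hk)]
    have h1 : (i : ℚ) < p := by exact_mod_cast hip
    have h2 : (p : ℚ) ≤ k := by exact_mod_cast hk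
    have h3 := add_div_le_factor (β := β) (c := 1) (hip.trans_le hk)
      (by linarith [hβ hk, hβ (Nat.le_sub_one_of_lt hip)])
    have h4 : ((k : ℚ) - i) / ((p : ℚ) - i) * (((k : ℚ) - i + 1) / ((k : ℚ) - i))
        = (((k + 1 : ℕ) : ℚ) - i) / ((p : ℚ) - i) := by
      have : (p : ℚ) - i ≠ 0 := by linarith
      have : (k : ℚ) - i ≠ 0 := by linarith
      push_cast
      field_simp
      ring
    rw [← h4]
    exact mul_le_mul ih h3 (div_nonneg (by linarith) (by linarith))
      (zero_le_one.trans (one_le_row hβ k i))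

theorem choose_le_slDim {β : ℕ → ℚ} (hβ : Antitone β) {k p : ℕ} (hpk : p ≤ k)
    (hp : β p + 1 ≤ β (p - 1)) : (k.choose p : ℚ) ≤ slDim k β := by
  have key : ∏ i ∈ range k, (if i < p then ((k : ℚ) - i) / ((p : ℚ) - i) else 1)
      = k.choose p := by
    rw [← prod_subset (range_subset_range.2 hpk)
      fun i _ hi => if_neg (by simpa using hi)]
    rw [prod_congr rfl fun i hi => if_pos (mem_range.1 hi), prod_div_distrib,
      Nat.choose_eq_descFactorial_div_factorial,
      Nat.cast_div (Nat.factorial_dvd_descFactorial _ _) (by positivity),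
      ← Nat.descFactorial_self, Nat.descFactorial_eq_prod_range, Nat.descFactorial_eq_prod_range]
    push_cast
    congr 1
    · exact prod_congr rfl fun i hi => by
        rw [Nat.cast_sub ((mem_range.1 hi).le.trans hpk)]
    · exact prod_congr rfl fun i hi => by rw [Nat.cast_sub (mem_range.1 hi).le]
  rw [← key]
  refine prod_le_slDim (fun i hi => ?_) fun i hi => ?_
  · have : (i : ℚ) < k := by exact_mod_cast hi
    split_ifs with h
    · have : (i : ℚ) < p := by exact_mod_cast h
      exact div_nonneg (by linarith) (by linarith)
    · exact zero_le_one
  · split_ifs with h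
    · exact div_le_row hβ h hpk hp
    · exact one_le_row hβ k i

theorem le_slDim_of_two_le_first_jump {β : ℕ → ℚ} (hβ : Antitone β) {k : ℕ} (hk : 1 ≤ k)
    (h : β 1 + 2 ≤ β 0) : (k : ℚ) * (k + 1) / 2 ≤ slDim k β := by
  have row : (k : ℚ) * (k + 1) / 2 ≤ ∏ j ∈ range k,
      if 0 < j then ((j : ℚ) - ((0 : ℕ) : ℚ) + β 0 - β j) / ((j : ℚ) - ((0 : ℕ) : ℚ)) else 1 := by
    induction k, hk using Nat.le_induction with
    | base => norm_num
    | succ k hk ih =>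
      rw [prod_range_succ, if_pos (show 0 < k from hk)]
      have h1 : (1 : ℚ) ≤ k := by exact_mod_cast hk
      have h3 := add_div_le_factor (β := β) (c := 2) (i := 0) hk (by linarith [hβ hk])
      have h4 : (k : ℚ) * (k + 1) / 2 * (((k : ℚ) - (0 : ℕ) + 2) / ((k : ℚ) - (0 : ℕ)))
          = ((k + 1 : ℕ) : ℚ) * ((k + 1 : ℕ) + 1) / 2 := by
        push_cast
        rw [sub_zero]
        field_simp
        ring
      rw [← h4]
      exact mul_le_mul ih h3 (div_nonneg (by push_cast; linarith) (by push_cast; linarith))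
        (zero_le_one.trans (one_le_row hβ k 0))
  obtain ⟨k, rfl⟩ : ∃ l, k = l + 1 := ⟨k - 1, by omega⟩
  have := prod_le_slDim (k := k + 1) (β := β)
    (g := fun i => if i = 0 then ((k + 1 : ℕ) : ℚ) * ((k + 1 : ℕ) + 1) / 2 else 1)
    (fun i _ => by split_ifs <;> positivity)
    (fun i _ => by
      split_ifs with hi
      · subst hi; exact row
      · exact one_le_row hβ _ i)
  simpa [prod_range_succ'] using this

theorem le_slDim_of_two_jumps {β : ℕ → ℚ} (hβ : Antitone β) {k : ℕ} (hk : 2 ≤ k)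
    (h0 : β 1 + 1 ≤ β 0) (h1 : β 2 + 1 ≤ β 1) : (k : ℚ) * (k - 1) ≤ slDim k β := by
  obtain ⟨k, rfl⟩ : ∃ l, k = l + 2 := ⟨k - 2, by omega⟩
  have := prod_le_slDim (k := k + 2) (β := β)
    (g := fun i => if i = 0 then ((k + 2 : ℕ) : ℚ) else if i = 1 then (k + 1 : ℚ) else 1)
    (fun i _ => by split_ifs <;> positivity)
    (fun i _ => by
      split_ifs with hi hi
      · subst hi
        simpa using div_le_row hβ (k := k + 2) (i := 0) (p := 1) (by omega) (by omega) h0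
      · subst hi
        refine le_trans (le_of_eq ?_)
          (div_le_row hβ (k := k + 2) (i := 1) (p := 2) (by omega) (by omega) h1)
        push_cast
        ring
      · exact one_le_row hβ _ i)
  simp [prod_range_succ'] at this
  push_cast
  linarith

theorem choose_two_le_choose {k p : ℕ} (hp : 2 ≤ p) (hpk : p + 2 ≤ k) :
    k.choose 2 ≤ k.choose p := by
  induction k generalizing p with
  | zero => omega
  | succ k ih =>
    rcases hp.eq_or_lt with rfl | hp'
    · rfl
    rcases hpk.eq_or_lt with h | h
    · rw [← Nat.choose_symm (show p ≤ k + 1 by omega), show k + 1 - p = 2 by omega]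
    · obtain ⟨p, rfl⟩ : ∃ q, p = q + 1 := ⟨p - 1, by omega⟩
      have h1 := ih (p := p) (by omega) (by omega)
      have h2 : k ≤ k.choose 2 := by
        rw [Nat.choose_two_right, Nat.le_div_iff_mul_le two_pos]
        exact Nat.mul_le_mul_left k (by omega)
      have h3 := Nat.choose_succ_succ k p
      have h4 : (k + 1).choose 2 = k.choose 1 + k.choose 2 := Nat.choose_succ_succ k 1
      have h5 := ih (p := p + 1) (by omega) (by omega)
      simp only [Nat.succ_eq_add_one, Nat.choose_one_right] at h3 h4
      omega

theorem slDim_succ (k : ℕ) (β : ℕ → ℚ) :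
    slDim (k + 1) β =
      slDim k β * ∏ i ∈ range k, ((k : ℚ) - (i : ℚ) + β i - β k) / ((k : ℚ) - (i : ℚ)) := by
  unfold slDim
  rw [prod_range_succ, prod_eq_one (s := range (k + 1)) fun j hj =>
    if_neg (by have := mem_range.1 hj; omega), mul_one, ← prod_mul_distrib]
  refine prod_congr rfl fun i hi => ?_
  rw [prod_range_succ, if_pos (mem_range.1 hi)]

theorem slDim_succ_of_two_rows {k : ℕ} (hk : 2 ≤ k) {β : ℕ → ℚ} (h : ∀ i, 2 ≤ i → β i = 0) :
    slDim (k + 1) β = slDim k β * ((k + β 0) / k * ((k - 1 + β 1) / (k - 1))) := by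
  rw [slDim_succ, ← prod_subset (range_subset_range.2 hk) fun i hi hi2 => ?_]
  · rw [prod_range_succ, prod_range_one, h k hk, Nat.cast_zero, Nat.cast_one, sub_zero, sub_zero,
      sub_zero]
  · have : (i : ℚ) < k := by exact_mod_cast mem_range.1 hi
    rw [h k hk, h i (not_lt.1 fun hlt => hi2 (mem_range.2 hlt)), add_zero, sub_zero, div_self (by linarith)]

theorem lw_eq_zero_of_length_le {l : List ℚ} {i : ℕ} (h : l.length ≤ i) : lw l i = 0 :=
  List.getD_eq_default _ _ h

theorem slDim_lw_one_one {k : ℕ} (hk : 2 ≤ k) : slDim k (lw [1, 1]) = k * (k - 1) / 2 := by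
  induction k, hk using Nat.le_induction with
  | base => norm_num [slDim, lw, prod_range_succ]
  | succ k hk ih =>
    have : (2 : ℚ) ≤ k := by exact_mod_cast hk
    have : (k : ℚ) - 1 ≠ 0 := by linarith
    rw [slDim_succ_of_two_rows hk fun i hi => lw_eq_zero_of_length_le (by simpa using hi), ih]
    simp only [lw, List.getD_cons_zero, List.getD_cons_succ]
    push_cast
    field_simp
    ring

theorem slDim_lw_two {k : ℕ} (hk : 2 ≤ k) : slDim k (lw [2]) = k * (k + 1) / 2 := by
  induction k, hk using Nat.le_induction with
  | base => norm_num [slDim, lw, prod_range_succ]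
  | succ k hk ih =>
    have : (2 : ℚ) ≤ k := by exact_mod_cast hk
    have : (k : ℚ) - 1 ≠ 0 := by linarith
    rw [slDim_succ_of_two_rows hk
      fun i hi => lw_eq_zero_of_length_le (by simp; omega), ih]
    simp only [lw, List.getD_cons_zero, List.getD_cons_succ, List.getD_nil, add_zero]
    push_cast
    field_simp
    ring

theorem slDim_four_lw_one_one_one : slDim 4 (lw [1, 1, 1]) = 4 := by
  norm_num [slDim, lw, prod_range_succ]

theorem slDim_six_lw_one_one_one : slDim 6 (lw [1, 1, 1]) = 20 := by
  norm_num [slDim, lw, prod_range_succ]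

theorem succ_mul_le_sum {b : ℕ → ℕ} (hb : Antitone b) {k i : ℕ} (hi : i < k) :
    (i + 1) * b i ≤ ∑ j ∈ range k, b j :=
  calc (i + 1) * b i ≤ ∑ j ∈ range (i + 1), b j := by
        simpa using card_nsmul_le_sum (range (i + 1)) b (b i)
          fun _ hj => hb (Nat.lt_succ_iff.1 (mem_range.1 hj))
    _ ≤ ∑ j ∈ range k, b j := sum_le_sum_of_subset (range_subset_range.2 hi)

theorem sum_range_eq_of_eq_zero {b : ℕ → ℕ} (hb : Antitone b) {k q : ℕ} (hq : q ≤ k)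
    (h : b q = 0) : ∑ j ∈ range k, b j = ∑ j ∈ range q, b j :=
  (sum_subset (range_subset_range.2 hq) fun _ _ hj =>
    Nat.le_zero.1 ((hb (not_lt.1 fun hlt => hj (mem_range.2 hlt))).trans h.le)).symm

theorem cast_eq_lw_of_three {b : ℕ → ℕ} (hb : Antitone b) (h : b 3 = 0) :
    (fun i => (b i : ℚ)) = lw [(b 0 : ℚ), (b 1 : ℚ), (b 2 : ℚ)] := by
  funext i
  match i with
  | 0 | 1 | 2 => rfl
  | i + 3 =>
    rw [lw_eq_zero_of_length_le (by simp), Nat.le_zero.1 ((hb (show 3 ≤ i + 3 by omega)).trans h.le),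
      Nat.cast_zero]

theorem lw_append_zero (l : List ℚ) : lw (l ++ [0]) = lw l := by
  funext i
  unfold lw
  rcases lt_or_ge i l.length with h | h
  · rw [List.getD_append _ _ _ _ h]
  · rw [List.getD_append_right _ _ _ _ h, List.getD_eq_default _ _ h]
    rcases (i - l.length).eq_zero_or_pos with h | h
    · simp [h]
    · exact List.getD_eq_default _ _ h

theorem cast_eq_of_sum_eq_one {b : ℕ → ℕ} (hb : Antitone b) {k : ℕ} (hk : 4 ≤ k)
    (h : ∑ j ∈ range k, b j = 1) : (fun i => (b i : ℚ)) = lw [1] := by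
  have h3 := succ_mul_le_sum hb (show 3 < k by omega)
  have h1 := succ_mul_le_sum hb (show 1 < k by omega)
  have h2 := hb (show 1 ≤ 2 by omega)
  have hs := sum_range_eq_of_eq_zero hb (show 3 ≤ k by omega) (by omega)
  rw [sum_range_succ, sum_range_succ, sum_range_one] at hs
  rw [cast_eq_lw_of_three hb (by omega), show b 0 = 1 by omega, show b 1 = 0 by omega,
    show b 2 = 0 by omega, Nat.cast_one, Nat.cast_zero]
  exact (lw_append_zero [1, 0]).trans (lw_append_zero [1])

theorem cast_eq_of_sum_eq_two {b : ℕ → ℕ} (hb : Antitone b) {k : ℕ} (hk : 4 ≤ k)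
    (h : ∑ j ∈ range k, b j = 2) :
    (fun i => (b i : ℚ)) = lw [1, 1] ∨ (fun i => (b i : ℚ)) = lw [2] := by
  have h3 := succ_mul_le_sum hb (show 3 < k by omega)
  have h2 := succ_mul_le_sum hb (show 2 < k by omega)
  have h1 := hb (show 0 ≤ 1 by omega)
  have hs := sum_range_eq_of_eq_zero hb (show 3 ≤ k by omega) (by omega)
  rw [sum_range_succ, sum_range_succ, sum_range_one] at hs
  rw [cast_eq_lw_of_three hb (by omega), show b 2 = 0 by omega]
  rcases (show b 0 = 1 ∧ b 1 = 1 ∨ b 0 = 2 ∧ b 1 = 0 by omega) with ⟨h0, h1⟩ | ⟨h0, h1⟩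
  · left
    rw [h0, h1, Nat.cast_one, Nat.cast_zero]
    exact lw_append_zero [1, 1]
  · right
    rw [h0, h1, Nat.cast_zero, Nat.cast_ofNat]
    exact (lw_append_zero [2, 0]).trans (lw_append_zero [2])

theorem cast_eq_or_jump_of_sum_eq_three {b : ℕ → ℕ} (hb : Antitone b) {k : ℕ} (hk : 4 ≤ k)
    (h : ∑ j ∈ range k, b j = 3) :
    (fun i => (b i : ℚ)) = lw [1, 1, 1] ∧ b 1 = 1 ∧ b 2 = 1 ∧ b 3 = 0 ∨
      b 0 = 2 ∧ b 1 = 1 ∧ b 2 = 0 ∨ b 0 = 3 ∧ b 1 = 0 := by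
  have h3 := succ_mul_le_sum hb (show 3 < k by omega)
  have h2 := succ_mul_le_sum hb (show 2 < k by omega)
  have h1 := hb (show 0 ≤ 1 by omega)
  have h12 := hb (show 1 ≤ 2 by omega)
  have hs := sum_range_eq_of_eq_zero hb (show 3 ≤ k by omega) (by omega)
  rw [sum_range_succ, sum_range_succ, sum_range_one] at hs
  rw [cast_eq_lw_of_three hb (by omega)]
  rcases (show b 0 = 1 ∧ b 1 = 1 ∧ b 2 = 1 ∨ b 0 = 2 ∧ b 1 = 1 ∧ b 2 = 0 ∨ b 0 = 3 ∧ b 1 = 0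
    by omega) with ⟨h0, h1, h2⟩ | h | h
  · left
    rw [h0, h1, h2, Nat.cast_one]
    exact ⟨rfl, rfl, rfl, by omega⟩
  · exact Or.inr (Or.inl h)
  · exact Or.inr (Or.inr h)

theorem cast_eq_lw_replicate {b : ℕ → ℕ} {k c : ℕ} (h : ∀ i < k, b i = c)
    (h0 : ∀ i, k ≤ i → b i = 0) : (fun i => (b i : ℚ)) = lw (List.replicate k (c : ℚ)) := by
  funext i
  unfold lw
  rcases lt_or_ge i k with hi | hi
  · rw [h i hi, List.getD_eq_getElem _ _ (by simpa using hi), List.getElem_replicate]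
  · rw [h0 i hi, Nat.cast_zero, List.getD_eq_default _ _ (by simpa using hi)]

theorem antitone_cast {b : ℕ → ℕ} (hb : Antitone b) : Antitone fun i => (b i : ℚ) :=
  fun _ _ h => Nat.cast_le.2 (hb h)

theorem choose_le_slDim_cast {b : ℕ → ℕ} (hb : Antitone b) {k p : ℕ} (hpk : p ≤ k)
    (hp : b p < b (p - 1)) : (k.choose p : ℚ) ≤ slDim k fun i => (b i : ℚ) :=
  choose_le_slDim (antitone_cast hb) hpk (by exact_mod_cast hp)

/-- A weight with no jump in the middle is constant away from its two ends. -/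
theorem eq_of_no_middle_jump {b : ℕ → ℕ} (hb : Antitone b) {k : ℕ}
    (h : ∀ p, 2 ≤ p → p + 2 ≤ k → b (p - 1) ≤ b p) (i : ℕ) (hi : 1 ≤ i) (hik : i + 2 ≤ k) :
    b i = b 1 := by
  induction i, hi using Nat.le_induction with
  | base => rfl
  | succ i hi ih =>
    rw [← ih (by omega)]
    exact le_antisymm (hb (by omega)) (h (i + 1) (by omega) hik)

theorem slDim_four_lw_two_one_one : slDim 4 (lw [2, 1, 1]) = 15 := by
  norm_num [slDim, lw, prod_range_succ]

/-- Weights of size at least three and small dimension. -/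
theorem cast_eq_of_sum_sub_two_mul_slDim_le {b : ℕ → ℕ} (hb : Antitone b) {k : ℕ} (hk : 4 ≤ k)
    (h0 : ∀ i, k ≤ i → b i = 0) (hd : 3 ≤ ∑ j ∈ range k, b j)
    (h : ((∑ j ∈ range k, b j : ℕ) - 2 : ℚ) * slDim k (fun i => (b i : ℚ)) ≤ 8) :
    (fun i => (b i : ℚ)) = lw (List.replicate k 1) ∧ k ≤ 10 ∨
      (fun i => (b i : ℚ)) = lw (List.replicate k 2) ∧ k ≤ 5 ∨
      (fun i => (b i : ℚ)) = lw [1, 1, 1] ∧ k = 4 := by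
  set d := ∑ j ∈ range k, b j with hdd
  set R := slDim k (fun i => (b i : ℚ)) with hR
  have hβ := antitone_cast hb
  have hR1 : 1 ≤ R := one_le_slDim hβ k
  have hd' : (3 : ℚ) ≤ d := by exact_mod_cast hd
  have hk' : (4 : ℚ) ≤ k := by exact_mod_cast hk
  -- Products of natural lower bounds for the size and the dimension.
  have bound : ∀ x y : ℕ, x + 2 ≤ d → (y : ℚ) ≤ R → x * y ≤ 8 := fun x y hx hy => by
    have hx' : (x : ℚ) + 2 ≤ d := by exact_mod_cast hx
    have : (x : ℚ) * y ≤ 8 :=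
      (mul_le_mul (by linarith) hy (Nat.cast_nonneg _) (by linarith)).trans h
    exact_mod_cast this
  have h2 : ¬ b 1 + 2 ≤ b 0 := fun hlt => by
    have := le_slDim_of_two_le_first_jump hβ (k := k) (by omega) (by exact_mod_cast hlt)
    have := bound 1 10 (by omega) (by push_cast; nlinarith)
    omega
  have h11 : b 1 + 1 ≤ b 0 → b 2 + 1 ≤ b 1 → False := fun hlt hlt' => by
    have := le_slDim_of_two_jumps hβ (k := k) (by omega) (by exact_mod_cast hlt)
      (by exact_mod_cast hlt')
    have := bound 1 12 (by omega) (by push_cast; nlinarith)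
    omega
  by_cases hmid : ∃ p, 2 ≤ p ∧ p + 2 ≤ k ∧ b p < b (p - 1)
  · obtain ⟨p, hp2, hpk, hp⟩ := hmid
    have hc := choose_le_slDim_cast hb (k := k) (by omega) hp
    have hc2 := bound 1 _ (by omega) hc
    have hc3 := choose_two_le_choose hp2 hpk
    have hk5 : k < 5 := by
      by_contra! hk5
      have := Nat.choose_le_choose 2 hk5
      rw [show Nat.choose 5 2 = 10 by rfl] at this
      omega
    obtain rfl : k = 4 := by omega
    obtain rfl : p = 2 := by omega
    rw [show 2 - 1 = 1 by rfl] at hp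
    have hd3 : d = 3 := by
      by_contra hne
      have := bound 2 _ (by omega) hc
      rw [show Nat.choose 4 2 = 6 by rfl] at this
      omega
    rcases cast_eq_or_jump_of_sum_eq_three hb le_rfl hd3 with h | h | h
    · omega
    · exact (h11 (by omega) (by omega)).elim
    · exact (h2 (by omega)).elim
  · push Not at hmid
    have hflat := eq_of_no_middle_jump hb hmid
    have hsum : d = b 0 + (k - 2) * b 1 + b (k - 1) := by
      obtain ⟨l, rfl⟩ : ∃ l, k = l + 2 := ⟨k - 2, by omega⟩
      rw [hdd, sum_range_succ, sum_range_succ', sum_congr (g := fun _ => b 1) rfl fun i hi =>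
        hflat (i + 1) (Nat.le_add_left 1 i) (by have := mem_range.1 hi; omega)]
      simp [add_comm]
    have h01 := hb (show 0 ≤ 1 by omega)
    have h1k := hb (show 1 ≤ k - 1 by omega)
    obtain ⟨l, rfl⟩ : ∃ l, k = l + 4 := ⟨k - 4, by omega⟩
    simp only [show l + 4 - 2 = l + 2 by omega, show l + 4 - 1 = l + 3 by omega] at *
    rcases Nat.eq_or_lt_of_le h1k with hy | hy
    · rcases Nat.eq_or_lt_of_le h01 with hx | hx
      · have hconst : ∀ i < l + 4, b i = b 0 := fun i hi =>
          le_antisymm (hb (Nat.zero_le _)) (by rw [← hx, ← hy]; exact hb (by omega))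
        have hle := bound (d - 2) 1 (by omega) (by exact_mod_cast hR1)
        have hb0 : b 0 = 1 ∨ b 0 = 2 := by
          have : b 0 ≠ 0 := fun hz => by
            have h1 : b 1 = 0 := by omega
            rw [h1] at hsum
            omega
          have : b 0 < 3 := by
            by_contra! h3
            have := Nat.mul_le_mul_left (l + 2) (hx ▸ h3)
            omega
          omega
        rcases hb0 with hb0 | hb0
        · left
          refine ⟨by simpa using cast_eq_lw_replicate (c := 1) (by simpa [hb0] using hconst) h0, ?_⟩
          rw [show b 1 = 1 by omega] at hsum
          omega
        · right; left
          refine ⟨by simpa using cast_eq_lw_replicate (c := 2) (by simpa [hb0] using hconst) h0, ?_⟩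
          rw [show b 1 = 2 by omega] at hsum
          omega
      · exfalso
        have hc := choose_le_slDim_cast hb (p := 1) (k := l + 4) (by omega) hx
        rw [Nat.choose_one_right] at hc
        have hb1 : 1 ≤ b 1 := by
          by_contra! hb1
          obtain hb1 : b 1 = 0 := by omega
          rw [hb1] at hsum
          omega
        have := Nat.mul_le_mul_left (l + 2) hb1
        have := bound 3 (l + 4) (by omega) hc
        omega
    · have hc := choose_le_slDim_cast hb (p := l + 3) (k := l + 4) (by omega)
        (by rwa [show l + 3 - 1 = l + 2 by omega, hflat (l + 2) (by omega) (by omega)])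
      rw [Nat.choose_symm_of_eq_add (b := 1) (by omega), Nat.choose_one_right] at hc
      have hb1 : 1 ≤ b 1 := by omega
      have hb1' := Nat.mul_le_mul_left (l + 2) hb1
      have hl : l = 0 := by
        by_contra hl
        have := bound 2 (l + 4) (by omega) hc
        omega
      subst hl
      simp only [Nat.zero_add] at *
      have hd4 : d ≤ 4 := by
        by_contra! hd4
        have := bound 3 4 (by omega) (by simpa using hc)
        omega
      have e2 := hflat 2 (by omega) (by omega)
      have e1 : b 1 = 1 := by omega
      have e3 : b 3 = 0 := by omega
      rcases (show b 0 = 1 ∨ b 0 = 2 by omega) with e0 | e0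
      · right; right
        refine ⟨?_, trivial⟩
        rw [cast_eq_lw_of_three hb e3, e0, e2, e1, Nat.cast_one]
      · exfalso
        have : R = 15 := by
          rw [hR, cast_eq_lw_of_three hb e3, e0, e2, e1, Nat.cast_one, Nat.cast_ofNat]
          exact slDim_four_lw_two_one_one
        have := bound 1 15 (by omega) (by rw [this]; norm_num)
        omega

theorem headSum_lw {k : ℕ} {l : List ℚ} (h : l.length ≤ k) : headSum k (lw l) = l.sum := by
  induction l generalizing k with
  | nil => simp [headSum, lw]
  | cons x l ih =>
    obtain ⟨k, rfl⟩ : ∃ m, k = m + 1 := ⟨k - 1, by simp at h; omega⟩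
    rw [List.sum_cons, ← ih (Nat.le_of_succ_le_succ h), headSum, sum_range_succ', add_comm]
    rfl

theorem slDim_lw_replicate (k : ℕ) (c : ℚ) : slDim k (lw (List.replicate k c)) = 1 :=
  slDim_const k c fun i hi => by simp [lw, hi]

theorem grRank_eq_slDim {k : ℕ} (n : ℕ) {β : ℕ → ℚ} (h : ∀ j, k ≤ j → β j = 0) :
    grRank k n β = slDim k β := by
  rw [grRank, slDim_const (n - k) 0 fun i _ => h _ (Nat.le_add_right k i), mul_one]

theorem mul_grDex_eq {k : ℕ} (hk : k ≠ 0) (n : ℕ) {β : ℕ → ℚ} (h : ∀ j, k ≤ j → β j = 0) :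
    (k : ℚ) * grDex k n β = headSum k β * slDim k β := by
  have : (k : ℚ) ≠ 0 := by exact_mod_cast hk
  rw [grDex, grRank_eq_slDim n h, sum_eq_zero fun i _ => h _ (Nat.le_add_right k i), zero_div,
    sub_zero]
  field_simp

theorem exists_nat_of_isGrWeight {n k : ℕ} {β : ℕ → ℚ} (hβ : IsGrWeight n β)
    (h : ∀ j, k ≤ j → β j = 0) :
    ∃ b : ℕ → ℕ, Antitone b ∧ (∀ i, k ≤ i → b i = 0) ∧ β = fun i => (b i : ℚ) := by
  have key : ∀ i, ∃ z : ℕ, β i = z := fun i => by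
    obtain ⟨z, hz⟩ := hβ.1 i
    have h0 : (0 : ℚ) ≤ β i := by
      rw [← h (i + k) (Nat.le_add_left k i)]
      exact hβ.2.1 i _ (Nat.le_add_right i k)
    rw [hz] at h0
    obtain ⟨m, rfl⟩ := Int.eq_ofNat_of_zero_le (Int.cast_nonneg_iff.1 h0)
    exact ⟨m, by simpa using hz⟩
  choose b hb using key
  refine ⟨b, fun i j hij => ?_, fun i hi => ?_, funext hb⟩
  · have := hβ.2.1 i j hij
    rw [hb, hb] at this
    exact_mod_cast this
  · have := hb i
    rw [h i hi] at this
    exact_mod_cast this.symm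

theorem two_le_sum_of_ne {b : ℕ → ℕ} (hb : Antitone b) {k : ℕ} (hk : 4 ≤ k)
    (hk0 : ∀ i, k ≤ i → b i = 0) (h0 : (fun i => (b i : ℚ)) ≠ 0)
    (h1 : (fun i => (b i : ℚ)) ≠ lw [1]) : 2 ≤ ∑ j ∈ range k, b j := by
  by_contra! h
  rcases (show ∑ j ∈ range k, b j = 0 ∨ ∑ j ∈ range k, b j = 1 by omega) with h | h
  · refine h0 (funext fun i => ?_)
    rcases lt_or_ge i k with hi | hi
    · simpa using (sum_eq_zero_iff.1 h) i (mem_range.2 hi)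
    · simpa using hk0 i hi
  · exact h1 (cast_eq_of_sum_eq_one hb hk h)

theorem sum_headSum_sub_mul_slDim (k : ℕ) (c : ℚ) (S : Multiset (ℕ → ℚ)) :
    (S.map fun β => (headSum k β - c) * slDim k β).sum
      = (S.map fun β => headSum k β * slDim k β).sum - c * (S.map (slDim k)).sum := by
  simp only [sub_mul, Multiset.sum_map_sub, Multiset.sum_map_mul_left]

theorem headSum_cast (k : ℕ) (b : ℕ → ℕ) :
    headSum k (fun i => (b i : ℚ)) = (∑ j ∈ range k, b j : ℕ) := by
  rw [headSum, Nat.cast_sum]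

theorem exists_nsmul_singleton_of_forall_mem {α : Type*} {p q r s t : α} {P : Prop}
    {S : Multiset α} (h : ∀ x ∈ S, x = p ∨ x = q ∨ x = r ∨ x = s ∨ x = t ∧ P) :
    ∃ a b c e f : ℕ, (f = 0 ∨ P) ∧
      S = a • {p} + b • {q} + c • {r} + e • {s} + f • {t} := by
  induction S using Multiset.induction with
  | empty => exact ⟨0, 0, 0, 0, 0, Or.inl rfl, by simp⟩
  | cons x S ih =>
    obtain ⟨a, b, c, e, f, hf, rfl⟩ := ih fun y hy => h y (Multiset.mem_cons_of_mem hy)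
    rw [← Multiset.singleton_add]
    rcases h x (Multiset.mem_cons_self x _) with rfl | rfl | rfl | rfl | ⟨rfl, hP⟩
    · exact ⟨a + 1, b, c, e, f, hf, by simp only [add_smul, one_smul]; abel⟩
    · exact ⟨a, b + 1, c, e, f, hf, by simp only [add_smul, one_smul]; abel⟩
    · exact ⟨a, b, c + 1, e, f, hf, by simp only [add_smul, one_smul]; abel⟩
    · exact ⟨a, b, c, e + 1, f, hf, by simp only [add_smul, one_smul]; abel⟩
    · exact ⟨a, b, c, e, f + 1, Or.inr hP, by simp only [add_smul, one_smul]; abel⟩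

theorem bounded_multiplicities_classification :
    ∀ k ∈ Icc 4 10, ∀ δ ∈ range 3, ∀ c ∈ range 5, ∀ e ∈ range 2, ∀ f ∈ range 3,
    (f = 0 ∨ k = 4) → c * (k - 2) + e * (2 * k - 2) + 4 * f + k * δ = 8 →
    ∀ a ∈ range 5, ∀ b ∈ range 3,
    a * (k * (k - 1)) + b * (k * (k + 1)) + 2 * c + 2 * e + 8 * f + 8 = 2 * (k * (k + δ)) →
    (k, δ, a, b, c, e, f) ∈ [(4, 1, 2, 0, 0, 0, 1), (5, 0, 2, 0, 0, 1, 0), (6, 0, 2, 0, 2, 0, 0),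
      (5, 1, 1, 1, 1, 0, 0), (4, 2, 0, 2, 0, 0, 0), (4, 0, 0, 1, 1, 1, 0),
      (4, 0, 1, 0, 2, 0, 1)] := by
  decide +kernel

theorem multiplicities_classification {k δ a b c e f : ℕ} (hk : 4 ≤ k) (hk' : k ≤ 10)
    (hf : f = 0 ∨ k = 4) (h1 : c * (k - 2) + e * (2 * k - 2) + 4 * f + k * δ = 8)
    (h2 : a * (k * (k - 1)) + b * (k * (k + 1)) + 2 * c + 2 * e + 8 * f + 8 = 2 * (k * (k + δ))) :
    k = 4 ∧ δ = 1 ∧ a = 2 ∧ b = 0 ∧ c = 0 ∧ e = 0 ∧ f = 1 ∨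
    k = 5 ∧ δ = 0 ∧ a = 2 ∧ b = 0 ∧ c = 0 ∧ e = 1 ∧ f = 0 ∨
    k = 6 ∧ δ = 0 ∧ a = 2 ∧ b = 0 ∧ c = 2 ∧ e = 0 ∧ f = 0 ∨
    k = 5 ∧ δ = 1 ∧ a = 1 ∧ b = 1 ∧ c = 1 ∧ e = 0 ∧ f = 0 ∨
    k = 4 ∧ δ = 2 ∧ a = 0 ∧ b = 2 ∧ c = 0 ∧ e = 0 ∧ f = 0 ∨
    k = 4 ∧ δ = 0 ∧ a = 0 ∧ b = 1 ∧ c = 1 ∧ e = 1 ∧ f = 0 ∨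
    k = 4 ∧ δ = 0 ∧ a = 1 ∧ b = 0 ∧ c = 2 ∧ e = 0 ∧ f = 1 := by
  have hδ := Nat.mul_le_mul_right δ hk
  have hkδ : k * δ ≤ 8 := by omega
  have hc := Nat.mul_le_mul_left c (show 2 ≤ k - 2 by omega)
  have he := Nat.mul_le_mul_left e (show 6 ≤ 2 * k - 2 by omega)
  have ha : a < 5 := by
    by_contra! ha
    have h3 := Nat.mul_le_mul_right (k * (k - 1)) ha
    obtain ⟨l, rfl⟩ : ∃ l, k = l + 4 := ⟨k - 4, by omega⟩
    simp only [show l + 4 - 1 = l + 3 by omega] at h2 h3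
    nlinarith [Nat.zero_le (b * ((l + 4) * (l + 4 + 1)))]
  have hb : b < 3 := by
    by_contra! hb
    have h3 := Nat.mul_le_mul_right (k * (k + 1)) hb
    nlinarith [Nat.zero_le (a * (k * (k - 1)))]
  simpa using bounded_multiplicities_classification k (mem_Icc.2 ⟨hk, hk'⟩) δ
    (mem_range.2 (by omega)) c (mem_range.2 (by omega)) e (mem_range.2 (by omega)) f
    (mem_range.2 (by omega)) hf h1 a (mem_range.2 ha) b (mem_range.2 hb) h2

/-- The case in which the pairs `(1, 1)` and `(2)` are allowed. -/
theorem classification_of_le {k δ : ℕ} (hk : 4 ≤ k) {S : Multiset (ℕ → ℚ)}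
    (hS : ∀ β ∈ S, ∃ b : ℕ → ℕ, Antitone b ∧ (∀ i, k ≤ i → b i = 0) ∧
      2 ≤ ∑ j ∈ range k, b j ∧ β = fun i => (b i : ℚ))
    (hr : (S.map (slDim k)).sum = k * (k + δ) - 4)
    (hd : (S.map fun β => headSum k β * slDim k β).sum = k * (k + (k + δ))) :
    (k = 4 ∧ δ = 1 ∧ S = {lw [1, 1, 1], lw [1, 1], lw [1, 1]}) ∨
    (k = 5 ∧ δ = 0 ∧ S = {lw [1, 1], lw [1, 1], lw [2, 2, 2, 2, 2]}) ∨
    (k = 6 ∧ δ = 0 ∧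
      S = {lw [1, 1], lw [1, 1], lw [1, 1, 1, 1, 1, 1], lw [1, 1, 1, 1, 1, 1]}) ∨
    (k = 5 ∧ δ = 1 ∧ S = {lw [1, 1], lw [2], lw [1, 1, 1, 1, 1]}) ∨
    (k = 4 ∧ δ = 2 ∧ S = {lw [2], lw [2]}) ∨
    (k = 4 ∧ δ = 0 ∧ S = {lw [2], lw [1, 1, 1, 1], lw [2, 2, 2, 2]}) ∨
    (k = 4 ∧ δ = 0 ∧ S = {lw [1, 1], lw [1, 1, 1], lw [1, 1, 1, 1], lw [1, 1, 1, 1]}) := by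
  have hsum : (S.map fun β => (headSum k β - 2) * slDim k β).sum = 8 - k * δ := by
    rw [sum_headSum_sub_mul_slDim, hr, hd]
    ring
  have hnn : ∀ x ∈ S.map fun β => (headSum k β - 2) * slDim k β, 0 ≤ x := fun x hx => by
    obtain ⟨β, hβ, rfl⟩ := Multiset.mem_map.1 hx
    obtain ⟨b, hb, _, h2, rfl⟩ := hS β hβ
    have h2' : (2 : ℚ) ≤ (∑ j ∈ range k, b j : ℕ) := by exact_mod_cast h2
    rw [headSum_cast]
    exact mul_nonneg (by linarith) (zero_le_one.trans (one_le_slDim (antitone_cast hb) k))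
  have hkδ : (0 : ℚ) ≤ k * δ := by positivity
  have hlarge : ∀ β ∈ S, headSum k β = 2 ∧ (β = lw [1, 1] ∨ β = lw [2]) ∨
      β = lw (List.replicate k 1) ∧ k ≤ 10 ∨ β = lw (List.replicate k 2) ∧ k ≤ 5 ∨
      β = lw [1, 1, 1] ∧ k = 4 := fun β hβ => by
    have hle := Multiset.single_le_sum hnn _ (Multiset.mem_map_of_mem _ hβ)
    obtain ⟨b, hb, h0, h2, rfl⟩ := hS β hβ
    rw [headSum_cast] at hle ⊢
    rcases h2.eq_or_lt with h2 | h2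
    · exact Or.inl ⟨by rw [← h2]; rfl, cast_eq_of_sum_eq_two hb hk h2.symm⟩
    · exact Or.inr (cast_eq_of_sum_sub_two_mul_slDim_le hb hk h0 h2 (by linarith))
  have hk10 : k ≤ 10 := by
    by_contra! hk10
    have h0 : (S.map fun β => (headSum k β - 2) * slDim k β).sum = 0 :=
      Multiset.sum_eq_zero fun x hx => by
        obtain ⟨β, hβ, rfl⟩ := Multiset.mem_map.1 hx
        rcases hlarge β hβ with h | h | h | h
        · rw [h.1, sub_self, zero_mul]
        all_goals omega
    have h8 : k * δ = 8 := by
      have : (k : ℚ) * δ = 8 := by linarith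
      exact_mod_cast this
    have := Nat.le_of_dvd (by norm_num) (Dvd.intro _ h8)
    omega
  obtain ⟨a, b, c, e, f, hf, rfl⟩ := exists_nsmul_singleton_of_forall_mem (P := k = 4)
    (p := lw [1, 1]) (q := lw [2]) (r := lw (List.replicate k 1)) (s := lw (List.replicate k 2))
    (t := lw [1, 1, 1]) (S := S) (fun β hβ => by have := hlarge β hβ; tauto)
  have hf4 : (f : ℚ) * slDim k (lw [1, 1, 1]) = 4 * f := by
    rcases hf with rfl | rfl
    · simp
    · rw [slDim_four_lw_one_one_one, mul_comm]
  simp only [Multiset.map_add, Multiset.map_nsmul, Multiset.map_singleton, Multiset.sum_add,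
    Multiset.sum_nsmul, Multiset.sum_singleton, nsmul_eq_mul,
    slDim_lw_one_one (show 2 ≤ k by omega), slDim_lw_two (show 2 ≤ k by omega),
    slDim_lw_replicate, headSum_lw (show [1, 1].length ≤ k by simp; omega),
    headSum_lw (show [2].length ≤ k by simp; omega),
    headSum_lw (show [1, 1, 1].length ≤ k by simp; omega),
    headSum_lw (List.length_replicate).le] at hr hsum
  norm_num at hr hsum
  have h1 : c * (k - 2) + e * (2 * k - 2) + 4 * f + k * δ = 8 := by
    have : (c * (k - 2) + e * (2 * k - 2) + 4 * f + k * δ : ℚ) = 8 := by linarith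
    have hc : ((k - 2 : ℕ) : ℚ) = k - 2 := by rw [Nat.cast_sub (by omega)]; rfl
    have he : ((2 * k - 2 : ℕ) : ℚ) = 2 * k - 2 := by
      rw [Nat.cast_sub (by omega)]
      push_cast
      rfl
    rw [← hc, ← he] at this
    exact_mod_cast this
  have h2 : a * (k * (k - 1)) + b * (k * (k + 1)) + 2 * c + 2 * e + 8 * f + 8
      = 2 * (k * (k + δ)) := by
    have : (a * (k * (k - 1)) + b * (k * (k + 1)) + 2 * c + 2 * e + 8 * f + 8 : ℚ)
      = 2 * (k * (k + δ)) := by linarith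
    rw [← Nat.cast_pred (by omega : 0 < k)] at this
    exact_mod_cast this
  clear hr hd hsum hS hnn hlarge hkδ hf4
  rcases multiplicities_classification hk hk10 hf h1 h2 with h | h | h | h | h | h | h <;>
  obtain ⟨rfl, rfl, rfl, rfl, rfl, rfl, rfl⟩ := h
  · refine Or.inl ⟨rfl, rfl, ?_⟩
    simp only [Multiset.insert_eq_cons, ← Multiset.singleton_add]
    abel
  · refine Or.inr (Or.inl ⟨rfl, rfl, ?_⟩)
    simp only [Multiset.insert_eq_cons, ← Multiset.singleton_add, List.replicate]
    abel
  · refine Or.inr (Or.inr (Or.inl ⟨rfl, rfl, ?_⟩))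
    simp only [Multiset.insert_eq_cons, ← Multiset.singleton_add, List.replicate]
    abel
  · refine Or.inr (Or.inr (Or.inr (Or.inl ⟨rfl, rfl, ?_⟩)))
    simp only [Multiset.insert_eq_cons, ← Multiset.singleton_add, List.replicate]
    abel
  · refine Or.inr (Or.inr (Or.inr (Or.inr (Or.inl ⟨rfl, rfl, ?_⟩))))
    simp only [Multiset.insert_eq_cons, ← Multiset.singleton_add]
    abel
  · refine Or.inr (Or.inr (Or.inr (Or.inr (Or.inr (Or.inl ⟨rfl, rfl, ?_⟩)))))
    simp only [Multiset.insert_eq_cons, ← Multiset.singleton_add, List.replicate]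
    abel
  · refine Or.inr (Or.inr (Or.inr (Or.inr (Or.inr (Or.inr ⟨rfl, rfl, ?_⟩)))))
    simp only [Multiset.insert_eq_cons, ← Multiset.singleton_add, List.replicate]
    abel

/-- The case in which the pairs `(1, 1)` and `(2)` are excluded. -/
theorem classification_of_lt {k m : ℕ} (hm : 4 ≤ m) (hmk : m < k) {S : Multiset (ℕ → ℚ)}
    (hS : ∀ β ∈ S, ∃ b : ℕ → ℕ, Antitone b ∧ (∀ i, k ≤ i → b i = 0) ∧
      3 ≤ ∑ j ∈ range k, b j ∧ β = fun i => (b i : ℚ))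
    (hr : (S.map (slDim k)).sum = k * m - 4)
    (hd : (S.map fun β => headSum k β * slDim k β).sum = k * (k + m)) :
    k = 6 ∧ m = 4 ∧ S = {lw [1, 1, 1]} := by
  have hkq : (m : ℚ) + 1 ≤ k := by exact_mod_cast hmk
  have hmq : (4 : ℚ) ≤ m := by exact_mod_cast hm
  have hR : ∀ β ∈ S, 1 ≤ slDim k β := fun β hβ => by
    obtain ⟨b, hb, _, _, rfl⟩ := hS β hβ
    exact one_le_slDim (antitone_cast hb) k
  have hsum : ∀ c : ℕ, (S.map fun β => (headSum k β - c) * slDim k β).sum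
      = k * (k + m) - c * (k * m - 4) := fun c => by
    rw [sum_headSum_sub_mul_slDim, hr, hd]
  have hnn : ∀ c : ℕ, (∀ β ∈ S, (c : ℚ) ≤ headSum k β) →
      ∀ x ∈ S.map fun β => (headSum k β - c) * slDim k β, 0 ≤ x := fun c hc x hx => by
    obtain ⟨β, hβ, rfl⟩ := Multiset.mem_map.1 hx
    exact mul_nonneg (sub_nonneg.2 (hc β hβ)) (zero_le_one.trans (hR β hβ))
  have h3 : ∀ β ∈ S, ((3 : ℕ) : ℚ) ≤ headSum k β := fun β hβ => by
    obtain ⟨b, _, _, h, rfl⟩ := hS β hβ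
    rw [headSum_cast]
    exact_mod_cast h
  have hquad : (2 : ℚ) * k * m ≤ k ^ 2 + 12 := by
    have := Multiset.sum_nonneg (hnn 3 h3)
    rw [hsum] at this
    push_cast at this
    linarith
  have hquad' : 2 * k * m ≤ k ^ 2 + 12 := by exact_mod_cast hquad
  rcases le_or_gt k 6 with hk6 | hk7
  · obtain ⟨rfl, rfl⟩ : k = 6 ∧ m = 4 := by
      interval_cases k <;> omega
    refine ⟨rfl, rfl, ?_⟩
    have hall : ∀ β ∈ S, β = lw [1, 1, 1] := fun β hβ => by
      have h1 := Multiset.single_le_sum (hnn 3 h3) _ (Multiset.mem_map_of_mem _ hβ)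
      have h2 : slDim 6 β ≤ (S.map (slDim 6)).sum :=
        Multiset.single_le_sum (fun x hx => by
          obtain ⟨γ, hγ, rfl⟩ := Multiset.mem_map.1 hx
          exact zero_le_one.trans (hR γ hγ)) _ (Multiset.mem_map_of_mem _ hβ)
      have h4 := hR β hβ
      rw [hsum] at h1
      rw [hr] at h2
      norm_num at h1 h2
      obtain ⟨b, hb, _, hb3, rfl⟩ := hS β hβ
      have hβ' := antitone_cast hb
      rw [headSum_cast] at h1
      have hd3 : ∑ j ∈ range 6, b j = 3 := by
        refine le_antisymm ?_ hb3
        have : ((∑ j ∈ range 6, b j : ℕ) : ℚ) ≤ 3 := by nlinarith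
        exact_mod_cast this
      rcases cast_eq_or_jump_of_sum_eq_three hb (by omega) hd3 with h | ⟨e0, e1, e2⟩ | ⟨e0, e1⟩
      · exact h.1
      · have := le_slDim_of_two_jumps hβ' (k := 6) (by omega) (by norm_num [e0, e1])
          (by norm_num [e1, e2])
        norm_num at this
        linarith
      · have := le_slDim_of_two_le_first_jump hβ' (k := 6) (by omega) (by norm_num [e0, e1])
        norm_num at this
        linarith
    rw [Multiset.eq_replicate_card.2 hall, Multiset.map_replicate, Multiset.sum_replicate,
      slDim_six_lw_one_one_one, nsmul_eq_mul] at hr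
    have hcard : S.card = 1 := by
      have : (S.card : ℚ) = 1 := by push_cast at hr; linarith
      exact_mod_cast this
    rw [Multiset.eq_replicate_card.2 hall, hcard, Multiset.replicate_one]
  · exfalso
    have hk7q : (7 : ℚ) ≤ k := by exact_mod_cast hk7
    have hbig : ∀ β ∈ S, ((k - 1 : ℕ) : ℚ) ≤ headSum k β := fun β hβ => by
      have h1 : headSum k β * slDim k β ≤ k * (k + m) := by
        rw [← hd]
        exact Multiset.single_le_sum (fun x hx => by
          obtain ⟨γ, hγ, rfl⟩ := Multiset.mem_map.1 hx
          exact mul_nonneg (le_trans (by norm_num) (h3 γ hγ)) (zero_le_one.trans (hR γ hγ))) _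
          (Multiset.mem_map_of_mem _ hβ)
      obtain ⟨b, hb, _, hb3, rfl⟩ := hS β hβ
      have hβ' := antitone_cast hb
      rw [headSum_cast] at h1 ⊢
      refine Nat.cast_le.2 ?_
      by_contra! hlt
      rcases hb3.eq_or_lt with hd3 | hd4
      · rw [← hd3] at h1
        push_cast at h1
        have hR2 : slDim k (fun i => (b i : ℚ)) ≤ (k ^ 2 + 4) / 2 := by linarith
        rcases cast_eq_or_jump_of_sum_eq_three hb (by omega) hd3.symm with
          ⟨-, -, e2, e3⟩ | ⟨e0, e1, e2⟩ | ⟨e0, e1⟩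
        · have := choose_le_slDim_cast hb (p := 3) (k := k) (by omega) (by rw [e3, e2]; norm_num)
          have hc : (k : ℚ) * ((k - 1) * (k - 2) / 2) = k.choose 3 * 3 := by
            obtain ⟨l, rfl⟩ : ∃ l, k = l + 1 := ⟨k - 1, by omega⟩
            have : ((l + 1 : ℕ) : ℚ) * l.choose 2 = (l + 1).choose 3 * 3 := by
              exact_mod_cast Nat.add_one_mul_choose_eq l 2
            rw [← this, Nat.cast_choose_two]
            push_cast
            ring
          nlinarith [mul_nonneg (sub_nonneg.2 hk7q) (sq_nonneg (k : ℚ))]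
        · have := le_slDim_of_two_jumps hβ' (k := k) (by omega) (by norm_num [e0, e1])
            (by norm_num [e1, e2])
          nlinarith
        · have := le_slDim_of_two_le_first_jump hβ' (k := k) (by omega) (by norm_num [e0, e1])
          nlinarith
      · have hd4' : (4 : ℚ) ≤ (∑ j ∈ range k, b j : ℕ) := by exact_mod_cast hd4
        suffices h : (k : ℚ) * (k - 1) / 2 ≤ slDim k (fun i => (b i : ℚ)) by
          have := mul_le_mul_of_nonneg_right hd4' (zero_le_one.trans (hR _ hβ))
          nlinarith
        have hz : b (k - 2) = 0 := by
          have := succ_mul_le_sum hb (show k - 2 < k by omega)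
          by_contra hz
          have := Nat.mul_le_mul_left (k - 2 + 1) (Nat.one_le_iff_ne_zero.2 hz)
          omega
        by_cases hmid : ∃ p, 2 ≤ p ∧ p + 2 ≤ k ∧ b p < b (p - 1)
        · obtain ⟨p, hp2, hpk, hp⟩ := hmid
          refine le_trans ?_ (choose_le_slDim_cast hb (k := k) (by omega) hp)
          rw [← Nat.cast_choose_two]
          exact_mod_cast choose_two_le_choose hp2 hpk
        · push Not at hmid
          have h1 : b 1 = 0 := by
            rw [← eq_of_no_middle_jump hb hmid (k - 2) (by omega) (by omega), hz]
          have hs := sum_range_eq_of_eq_zero hb (show 1 ≤ k by omega) h1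
          rw [sum_range_one] at hs
          have := le_slDim_of_two_le_first_jump hβ' (k := k) (by omega)
            (by rw [h1]; exact_mod_cast (show 0 + 2 ≤ b 0 by omega))
          linarith
    have := Multiset.sum_nonneg (hnn (k - 1) hbig)
    rw [hsum, Nat.cast_sub (by omega)] at this
    push_cast at this
    nlinarith [mul_nonneg (sub_nonneg.2 hk7q) (sub_nonneg.2 hmq), mul_self_nonneg (k : ℚ)]

/-- Classification of fourfolds with trivial canonical bundle in `Gr(k,n)`,
`k, n−k ≥ 4`, for bundles with `|β|₂ = 0`. -/
theorem stmt9 (k n : ℕ) (hk : 4 ≤ k) (hnk : 4 ≤ n - k)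
    (S : Multiset (ℕ → ℚ))
    (hw : ∀ β ∈ S, IsGrWeight n β ∧ β ≠ 0 ∧ (∀ j, k ≤ j → β j = 0) ∧ β ≠ lw [1])
    (h2k : 2 * k > n → ∀ β ∈ S, β ≠ lw [1, 1] ∧ β ≠ lw [2])
    (hr : (S.map (grRank k n)).sum = (k : ℚ) * ((n : ℚ) - (k : ℚ)) - 4)
    (hd : (S.map (grDex k n)).sum = (n : ℚ)) :
    (k = 4 ∧ n = 9 ∧ S = {lw [1, 1, 1], lw [1, 1], lw [1, 1]}) ∨
    (k = 5 ∧ n = 10 ∧ S = {lw [1, 1], lw [1, 1], lw [2, 2, 2, 2, 2]}) ∨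
    (k = 6 ∧ n = 12 ∧
      S = {lw [1, 1], lw [1, 1], lw [1, 1, 1, 1, 1, 1], lw [1, 1, 1, 1, 1, 1]}) ∨
    (k = 5 ∧ n = 11 ∧ S = {lw [1, 1], lw [2], lw [1, 1, 1, 1, 1]}) ∨
    (k = 4 ∧ n = 10 ∧ S = {lw [2], lw [2]}) ∨
    (k = 4 ∧ n = 8 ∧ S = {lw [2], lw [1, 1, 1, 1], lw [2, 2, 2, 2]}) ∨
    (k = 4 ∧ n = 8 ∧ S = {lw [1, 1], lw [1, 1, 1], lw [1, 1, 1, 1], lw [1, 1, 1, 1]}) ∨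
    (k = 6 ∧ n = 10 ∧ S = {lw [1, 1, 1]}) := by
  obtain ⟨m, rfl⟩ : ∃ m, n = k + m := ⟨n - k, by omega⟩
  have hm : 4 ≤ m := by omega
  have hz : ∀ β ∈ S, ∀ j, k ≤ j → β j = 0 := fun β hβ => (hw β hβ).2.2.1
  have hrank : (S.map (slDim k)).sum = k * m - 4 := by
    rw [← Multiset.map_congr rfl fun β hβ => grRank_eq_slDim (k + m) (hz β hβ), hr]
    push_cast
    ring
  have hdex : (S.map fun β => headSum k β * slDim k β).sum = k * (k + m) := by
    rw [← Multiset.map_congr rfl fun β hβ => mul_grDex_eq (by omega) (k + m) (hz β hβ),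
      Multiset.sum_map_mul_left, hd]
    push_cast
    ring
  have hS : ∀ β ∈ S, ∃ b : ℕ → ℕ, Antitone b ∧ (∀ i, k ≤ i → b i = 0) ∧
      2 ≤ ∑ j ∈ range k, b j ∧ β = fun i => (b i : ℚ) := fun β hβ => by
    obtain ⟨hGr, hne, hβz, h1⟩ := hw β hβ
    obtain ⟨b, hb, hb0, rfl⟩ := exists_nat_of_isGrWeight hGr hβz
    exact ⟨b, hb, hb0, two_le_sum_of_ne hb hk hb0 hne h1, rfl⟩
  rcases le_or_gt k m with hkm | hmk
  · obtain ⟨δ, rfl⟩ : ∃ δ, m = k + δ := ⟨m - k, by omega⟩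
    push_cast at hrank hdex
    rcases classification_of_le hk hS hrank hdex with h | h | h | h | h | h | h <;>
    obtain ⟨rfl, rfl, rfl⟩ := h <;> simp
  · obtain ⟨rfl, rfl, rfl⟩ := classification_of_lt hm hmk (fun β hβ => by
      obtain ⟨b, hb, hb0, h2, rfl⟩ := hS β hβ
      refine ⟨b, hb, hb0, lt_of_le_of_ne h2 fun h => ?_, rfl⟩
      have := h2k (by omega) _ hβ
      exact (cast_eq_of_sum_eq_two hb hk h.symm).elim this.1 this.2) hrank hdex
    simp
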